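/- Let k be a field in which 2 ≠ 0, m ≥ 1, and let z_1, …, z_m be pairwise distinct elements of k. Set f := ∏_{i=1}^m (X − z_i) ∈ k[X]. Then the following are equivalent: (i) for every j ∈ {1, …, m}, ∑_{s ≠ j} (z_j − z_s)⁻¹ = 0; (ii) the second formal derivative f'' is the zero polynomial. -/

import Mathlib

open Polynomial Finset

/-- The logarithmic derivative of a product of linear factors, at a point that is not a root. -/
theorem eval_derivative_prod_X_sub_C {k ι : Type*} [Field k] [DecidableEq ι] (S : Finset ι)
    (z : ι → k) (x : k) (hx : ∀ s ∈ S, x - z s ≠ 0) :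
    (derivative (∏ i ∈ S, (X - C (z i)))).eval x =
      (∏ i ∈ S, (x - z i)) * ∑ s ∈ S, (x - z s)⁻¹ := by
  simp only [derivative_prod_finset, derivative_X_sub_C, mul_one, eval_finsetSum, eval_prod,
    eval_sub, eval_X, eval_C, Finset.mul_sum]
  refine Finset.sum_congr rfl fun s hs => ?_
  rw [← Finset.mul_prod_erase S _ hs, mul_comm, inv_mul_cancel_left₀ (hx s hs)]

/-- The second derivative of `(X - a) * g` at `a` is `2 * g'(a)`. -/
theorem eval_derivative_derivative_X_sub_C_mul {k : Type*} [CommRing k] (a : k) (g : k[X]) :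
    (derivative (derivative ((X - C a) * g))).eval a = 2 * (derivative g).eval a := by
  simp [derivative_mul]
  ring

theorem stmt1 {k : Type*} [Field k] (h2 : (2 : k) ≠ 0) {m : ℕ} (hm : 1 ≤ m)
    (z : Fin m → k) (hz : Function.Injective z) (f : k[X])
    (hf : f = ∏ i, (X - C (z i))) :
    (∀ j : Fin m, ∑ s ∈ Finset.univ.erase j, (z j - z s)⁻¹ = 0) ↔
      derivative (derivative f) = 0 := by
  have hne (j : Fin m) : ∀ s ∈ Finset.univ.erase j, z j - z s ≠ 0 := fun s hs =>
    sub_ne_zero.2 fun h => Finset.ne_of_mem_erase hs (hz h).symm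
  have heval (j : Fin m) : (derivative (derivative f)).eval (z j) = 0 ↔
      ∑ s ∈ Finset.univ.erase j, (z j - z s)⁻¹ = 0 := by
    rw [hf, ← Finset.mul_prod_erase _ _ (Finset.mem_univ j),
      eval_derivative_derivative_X_sub_C_mul, eval_derivative_prod_X_sub_C _ _ _ (hne j),
      mul_eq_zero_iff_left h2, mul_eq_zero_iff_left (Finset.prod_ne_zero_iff.2 (hne j))]
  have hdeg : f.degree = m := by simp [hf, degree_prod]
  have hf0 : f ≠ 0 := by
    rintro rfl
    simp at hdeg
  simp only [← heval]
  refine ⟨fun h => ?_, fun h j => by simp [h]⟩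
  refine Polynomial.eq_zero_of_degree_lt_of_eval_index_eq_zero Finset.univ hz.injOn ?_
    fun j _ => h j
  calc (derivative (derivative f)).degree ≤ (derivative f).degree := degree_derivative_le
    _ < f.degree := degree_derivative_lt hf0
    _ = _ := by simp [hdeg]
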